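/- arXiv:1909.13729 — 3 statements merged into one kernel-verified Lean document; each statement's English description precedes it below -/
import Mathlib

section
/- Let R ⊊ S be a distributive FCP ring extension with Loewy series {S_i} and Loewy length n. Then n = ℓ[R,S] (the supremum of the lengths of chains in [R,S]) if and only if [R,S] is a chain, i.e. any two R-subalgebras of S are comparable; and in that case [R,S] = {S_0, S_1, …, S_n}. -/
/-- The Loewy series of the ring extension `R ⊆ S`: `S_0 = ⊥` and
`S_{i+1} = S_i ⊔ sSup {A | S_i ⋖ A}`. -/
noncomputable def loewySeries (R S : Type*) [CommRing R] [CommRing S] [Algebra R S] :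
    ℕ → Subalgebra R S
  | 0 => ⊥
  | n + 1 => loewySeries R S n ⊔ sSup {A : Subalgebra R S | loewySeries R S n ⋖ A}

section LoewySeries

variable {R S : Type*} [CommRing R] [CommRing S] [Algebra R S]

theorem CovBy.le_loewySeries_succ {i : ℕ} {A : Subalgebra R S} (h : loewySeries R S i ⋖ A) :
    A ≤ loewySeries R S (i + 1) := by
  rw [loewySeries]
  exact le_sup_of_le_right (le_sSup h)

theorem loewySeries_lt_succ [WellFoundedLT (Subalgebra R S)] {i : ℕ}
    (h : loewySeries R S i ≠ ⊤) : loewySeries R S i < loewySeries R S (i + 1) := by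
  obtain ⟨A, hA, -⟩ := exists_covBy_le_of_lt h.lt_top
  exact hA.lt.trans_le hA.le_loewySeries_succ

/-- In a strictly increasing stretch of the Loewy series, each step raises the height by at
least one. -/
theorem add_le_height_loewySeries {n i c : ℕ}
    (hlt : ∀ j < n, loewySeries R S j < loewySeries R S (j + 1))
    (hc : (c : ℕ∞) ≤ Order.height (loewySeries R S i)) (k : ℕ) (hk : i + k ≤ n) :
    ((c + k : ℕ) : ℕ∞) ≤ Order.height (loewySeries R S (i + k)) := by
  induction k with
  | zero => simpa using hc
  | succ k ih =>
    refine le_trans ?_ (Order.height_add_one_le (hlt (i + k) (by omega)))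
    have := add_le_add_left (ih (by omega)) 1
    exact_mod_cast this

theorem loewySeries_covBy_succ_of_krullDim_le {n : ℕ}
    (hlt : ∀ j < n, loewySeries R S j < loewySeries R S (j + 1))
    (hdim : Order.krullDim (Subalgebra R S) ≤ n) {i : ℕ} (hi : i < n) :
    loewySeries R S i ⋖ loewySeries R S (i + 1) := by
  refine ⟨hlt i hi, fun B hiB hBi => ?_⟩
  have h₀ : (i : ℕ∞) ≤ Order.height (loewySeries R S i) := by
    simpa using add_le_height_loewySeries (c := 0) (i := 0) hlt (by simp) i (by omega)
  have h₁ : ((i + 1 + 1 : ℕ) : ℕ∞) ≤ Order.height (loewySeries R S (i + 1)) := by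
    push_cast
    calc (i : ℕ∞) + 1 + 1 ≤ Order.height B + 1 := by
          gcongr
          exact (add_le_add_left h₀ 1).trans (Order.height_add_one_le hiB)
      _ ≤ _ := Order.height_add_one_le hBi
  have h₂ := add_le_height_loewySeries hlt h₁ (n - (i + 1)) (by omega)
  have h₃ : (((i + 1 + 1 + (n - (i + 1)) : ℕ) : ℕ∞) : WithBot ℕ∞) ≤ ((n : ℕ∞) : WithBot ℕ∞) :=
    (WithBot.coe_le_coe.mpr h₂).trans ((Order.height_le_krullDim _).trans hdim)
  have h₄ : i + 1 + 1 + (n - (i + 1)) ≤ n := by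
    exact_mod_cast h₃
  omega

theorem loewySeries_covBy_succ_of_total [WellFoundedLT (Subalgebra R S)]
    (htot : ∀ T U : Subalgebra R S, T ≤ U ∨ U ≤ T) {i : ℕ} (h : loewySeries R S i ≠ ⊤) :
    loewySeries R S i ⋖ loewySeries R S (i + 1) := by
  obtain ⟨A, hA, -⟩ := exists_covBy_le_of_lt h.lt_top
  have hsucc : loewySeries R S (i + 1) = A := by
    refine le_antisymm ?_ hA.le_loewySeries_succ
    rw [loewySeries]
    refine sup_le hA.le (sSup_le fun B hB => ?_)
    rcases htot B A with hBA | hAB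
    · exact hBA
    · exact ((CovBy.eq_or_eq hB hA.le hAB).resolve_left hA.lt.ne').ge
  rwa [hsucc]

theorem exists_eq_loewySeries_of_covBy_succ [WellFoundedLT (Subalgebra R S)] {n : ℕ}
    (htop : loewySeries R S n = ⊤)
    (hcov : ∀ i < n, loewySeries R S i ⋖ loewySeries R S (i + 1)) (T : Subalgebra R S) :
    ∃ i ≤ n, T = loewySeries R S i := by
  by_contra! hne
  have hle : ∀ i ≤ n, loewySeries R S i ≤ T := by
    intro i
    induction i with
    | zero => intro _; rw [loewySeries]; exact bot_le
    | succ i ih =>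
      intro hi
      obtain ⟨A, hA, hAT⟩ :=
        exists_covBy_le_of_lt ((ih (by omega)).lt_of_ne (hne i (by omega)).symm)
      have := ((hcov i hi).eq_or_eq hA.le hA.le_loewySeries_succ).resolve_left hA.lt.ne'
      exact this ▸ hAT
  exact hne n le_rfl ((htop ▸ le_top).antisymm (hle n le_rfl))

theorem krullDim_le_of_forall_exists_eq_loewySeries {n : ℕ}
    (h : ∀ T : Subalgebra R S, ∃ i ≤ n, T = loewySeries R S i) :
    Order.krullDim (Subalgebra R S) ≤ n := by
  choose f hfn hf using h
  refine iSup_le fun p => ?_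
  have hinj : Function.Injective
      fun j : Fin (p.length + 1) => (⟨f (p j), Nat.lt_succ_of_le (hfn _)⟩ : Fin (n + 1)) := by
    intro j k hjk
    refine p.strictMono.injective ?_
    rw [hf (p j), hf (p k), Fin.mk.inj hjk]
  have := Fintype.card_le_of_injective _ hinj
  simp only [Fintype.card_fin, Nat.add_le_add_iff_right] at this
  exact_mod_cast this

end LoewySeries

theorem loewyLength_eq_length_iff_chain
    {R S : Type*} [CommRing R] [CommRing S] [Algebra R S]
    (hinj : Function.Injective (algebraMap R S))
    [WellFoundedLT (Subalgebra R S)] [WellFoundedGT (Subalgebra R S)]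
    (hRS : (⊥ : Subalgebra R S) ≠ ⊤)
    (hdist : ∀ a b c : Subalgebra R S, a ⊓ (b ⊔ c) = (a ⊓ b) ⊔ (a ⊓ c))
    (n : ℕ) (hn : IsLeast {m : ℕ | loewySeries R S m = ⊤} n) :
    (((n : WithBot ℕ∞) = Order.krullDim (Subalgebra R S)) ↔
      (∀ T U : Subalgebra R S, T ≤ U ∨ U ≤ T)) ∧
    ((∀ T U : Subalgebra R S, T ≤ U ∨ U ≤ T) →
      ∀ T : Subalgebra R S, ∃ i ≤ n, T = loewySeries R S i) := by
  obtain ⟨htop, hleast⟩ := hn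
  have hne : ∀ i < n, loewySeries R S i ≠ ⊤ := fun i hi h => (hleast h).not_gt hi
  have hlt : ∀ i < n, loewySeries R S i < loewySeries R S (i + 1) :=
    fun i hi => loewySeries_lt_succ (hne i hi)
  have hall (htot : ∀ T U : Subalgebra R S, T ≤ U ∨ U ≤ T) (T : Subalgebra R S) :
      ∃ i ≤ n, T = loewySeries R S i :=
    exists_eq_loewySeries_of_covBy_succ htop
      (fun i hi => loewySeries_covBy_succ_of_total htot (hne i hi)) T
  refine ⟨⟨fun hdim T U => ?_, fun htot => ?_⟩, hall⟩
  · have hex := exists_eq_loewySeries_of_covBy_succ htop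
      fun i hi => loewySeries_covBy_succ_of_krullDim_le hlt hdim.ge hi
    obtain ⟨i, -, rfl⟩ := hex T
    obtain ⟨j, -, rfl⟩ := hex U
    have hmono : Monotone (loewySeries R S) := monotone_nat_of_le_succ fun k => by
      conv_rhs => rw [loewySeries]
      exact le_sup_left
    exact (le_total i j).imp (fun h => hmono h) fun h => hmono h
  · refine le_antisymm ?_ (krullDim_le_of_forall_exists_eq_loewySeries (hall htot))
    have h := add_le_height_loewySeries (c := 0) (i := 0) hlt (by simp) n (by omega)
    rw [zero_add] at h
    exact (WithBot.coe_le_coe.mpr h).trans (Order.height_le_krullDim _)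
end

section
/- Let k ⊊ L be a finite Galois field extension whose Galois group L ≃ₐ[k] L is cyclic, set n := Module.finrank k L, and let {S_j} be the Loewy series of [k,L]. Then for every j, Module.finrank k (S_j) = ∏_{p ∈ n.primeFactors} p^{min(j, n.factorization p)}; consequently the Loewy length £[k,L] equals the largest exponent occurring in the prime factorization of n, i.e. the supremum over p ∈ n.primeFactors of n.factorization p. -/
/-- The Loewy series of the field extension `k ⊆ L`: `S_0 = ⊥` and
`S_{j+1} = S_j ⊔ sSup {A | S_j ⋖ A}`. -/
noncomputable def loewySeriesField (k L : Type*) [Field k] [Field L] [Algebra k L] :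
    ℕ → IntermediateField k L
  | 0 => ⊥
  | j + 1 => loewySeriesField k L j ⊔
      sSup {A : IntermediateField k L | loewySeriesField k L j ⋖ A}

/-- In a finite cyclic group, subgroups are ordered by divisibility of their cardinalities. -/
theorem IsCyclic.le_of_natCard_dvd {G : Type*} [Group G] [Finite G] [IsCyclic G]
    {H K : Subgroup G} (h : Nat.card H ∣ Nat.card K) : H ≤ K := by
  classical
  have := Fintype.ofFinite G
  intro x hx
  have hsub : (K : Set G).toFinset ⊆ Finset.univ.filter fun a : G => a ^ Nat.card K = 1 := by
    intro a ha
    exact Finset.mem_filter.mpr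
      ⟨Finset.mem_univ a, orderOf_dvd_iff_pow_eq_one.mp (K.orderOf_dvd_natCard (Set.mem_toFinset.mp ha))⟩
  have heq := Finset.eq_of_subset_of_card_le hsub (by
    refine (IsCyclic.card_pow_eq_one_le Nat.card_pos).trans ?_
    simp [Nat.card_eq_fintype_card])
  have hmem : x ∈ Finset.univ.filter fun a : G => a ^ Nat.card K = 1 := by
    exact Finset.mem_filter.mpr ⟨Finset.mem_univ x,
      orderOf_dvd_iff_pow_eq_one.mp ((H.orderOf_dvd_natCard hx).trans h)⟩
  rw [← heq] at hmem
  simpa using hmem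

/-- A finite cyclic group has a subgroup of every order dividing that of the group. -/
theorem IsCyclic.exists_subgroup_natCard_eq {G : Type*} [Group G] [Finite G] [IsCyclic G]
    {d : ℕ} (hd : d ∣ Nat.card G) : ∃ H : Subgroup G, Nat.card H = d := by
  obtain ⟨g, hg⟩ := IsCyclic.exists_ofOrder_eq_natCard (α := G)
  refine ⟨Subgroup.zpowers (g ^ (Nat.card G / d)), ?_⟩
  rw [Nat.card_zpowers, ← hg]
  exact orderOf_pow_orderOf_div (hg ▸ Nat.card_pos.ne') (hg ▸ hd)

namespace IntermediateField

variable {k L : Type*} [Field k] [Field L] [Algebra k L]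

theorem finrank_dvd_finrank_of_le {A B : IntermediateField k L} (h : A ≤ B) :
    Module.finrank k A ∣ Module.finrank k B :=
  ⟨_, (finrank_bot_mul_relfinrank h).symm⟩

theorem finrank_dvd_finrank (A : IntermediateField k L) :
    Module.finrank k A ∣ Module.finrank k L :=
  ⟨_, (Module.finrank_mul_finrank k A L).symm⟩

variable [FiniteDimensional k L]

theorem factorization_finrank_le_of_le {A B : IntermediateField k L} (h : A ≤ B) (q : ℕ) :
    (Module.finrank k A).factorization q ≤ (Module.finrank k B).factorization q :=
  (Nat.factorization_le_iff_dvd (Module.finrank_pos (R := k) (M := A)).ne'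
    (Module.finrank_pos (R := k) (M := B)).ne').mpr (finrank_dvd_finrank_of_le h) q

/-- An extension of prime relative degree is a cover. -/
theorem covBy_of_finrank_eq_prime_mul {A B : IntermediateField k L} {p : ℕ} (hp : p.Prime)
    (hAB : A ≤ B) (h : Module.finrank k B = p * Module.finrank k A) : A ⋖ B := by
  have hpos : 0 < Module.finrank k A := Module.finrank_pos
  refine ⟨lt_of_le_of_ne hAB ?_, fun C hAC hCB => ?_⟩
  · rintro rfl
    exact hp.one_lt.ne (Nat.eq_of_mul_eq_mul_right hpos (by rw [one_mul]; exact h))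
  · obtain ⟨c, hc⟩ := finrank_dvd_finrank_of_le hAC.le
    have hcp : c ∣ p := by
      have hdvd := finrank_dvd_finrank_of_le hCB.le
      rw [h, hc, mul_comm p] at hdvd
      exact Nat.dvd_of_mul_dvd_mul_left hpos hdvd
    rcases (Nat.dvd_prime hp).mp hcp with rfl | rfl
    · exact hAC.ne (eq_of_le_of_finrank_eq hAC.le (by simpa using hc.symm))
    · exact hCB.ne (eq_of_le_of_finrank_eq hCB.le (by rw [h, hc, mul_comm]))

variable [IsGalois k L] [IsCyclic (L ≃ₐ[k] L)]

/-- In a cyclic extension, intermediate fields are ordered by divisibility of their degrees. -/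
theorem le_iff_finrank_dvd_of_isCyclic {A B : IntermediateField k L} :
    A ≤ B ↔ Module.finrank k A ∣ Module.finrank k B := by
  refine ⟨finrank_dvd_finrank_of_le, fun h => ?_⟩
  rw [← IsGalois.fixedField_fixingSubgroup B, le_iff_le]
  apply IsCyclic.le_of_natCard_dvd
  rw [IsGalois.card_fixingSubgroup_eq_finrank, IsGalois.card_fixingSubgroup_eq_finrank]
  obtain ⟨c, hc⟩ := h
  refine ⟨c, Nat.eq_of_mul_eq_mul_left (Module.finrank_pos (R := k) (M := A)) ?_⟩
  rw [Module.finrank_mul_finrank, ← Module.finrank_mul_finrank k B L, hc]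
  ring

/-- A cyclic extension has an intermediate field of every degree dividing its degree. -/
theorem exists_finrank_eq_of_isCyclic {d : ℕ} (hd : d ∣ Module.finrank k L) :
    ∃ A : IntermediateField k L, Module.finrank k A = d := by
  obtain ⟨c, hc⟩ := hd
  obtain ⟨H, hH⟩ := IsCyclic.exists_subgroup_natCard_eq (G := L ≃ₐ[k] L) (d := c)
    (by rw [IsGalois.card_aut_eq_finrank, hc]; exact dvd_mul_left c d)
  refine ⟨fixedField H, ?_⟩
  have hmul := Module.finrank_mul_finrank k (fixedField H) L
  rw [finrank_fixedField_eq_card, hH, hc] at hmul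
  exact Nat.eq_of_mul_eq_mul_right (hH ▸ Nat.card_pos) hmul

/-- In a cyclic extension every cover has prime relative degree. -/
theorem exists_prime_finrank_eq_mul_of_covBy {A B : IntermediateField k L} (h : A ⋖ B) :
    ∃ p : ℕ, p.Prime ∧ Module.finrank k B = p * Module.finrank k A := by
  obtain ⟨m, hm⟩ := finrank_dvd_finrank_of_le h.le
  have hm1 : m ≠ 1 := by
    rintro rfl
    exact h.ne (eq_of_le_of_finrank_eq h.le (by simpa using hm.symm))
  obtain ⟨p, hp, hpm⟩ := Nat.exists_prime_and_dvd hm1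
  have hdvd : p * Module.finrank k A ∣ Module.finrank k B := by
    rw [hm, mul_comm]
    exact mul_dvd_mul_left _ hpm
  obtain ⟨C, hC⟩ := exists_finrank_eq_of_isCyclic (hdvd.trans (finrank_dvd_finrank B))
  have hAC : A ⋖ C := covBy_of_finrank_eq_prime_mul hp
    (le_iff_finrank_dvd_of_isCyclic.mpr (hC ▸ dvd_mul_left _ _)) hC
  have hCB : C ≤ B := le_iff_finrank_dvd_of_isCyclic.mpr (hC ▸ hdvd)
  refine ⟨p, hp, ?_⟩
  rw [← hC, (h.eq_or_eq hAC.le hCB).resolve_left hAC.ne']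

end IntermediateField

/-- The truncation of `n` at level `j`: every exponent in the prime factorization of `n` is
replaced by its minimum with `j`. -/
def Nat.factorizationTrunc (n j : ℕ) : ℕ :=
  ∏ p ∈ n.primeFactors, p ^ min j (n.factorization p)

namespace Nat

theorem factorizationTrunc_ne_zero (n j : ℕ) : n.factorizationTrunc j ≠ 0 :=
  Finset.prod_ne_zero_iff.mpr fun _ hp => pow_ne_zero _ (prime_of_mem_primeFactors hp).ne_zero

theorem factorization_factorizationTrunc (n j q : ℕ) :
    (n.factorizationTrunc j).factorization q = min j (n.factorization q) := by
  rw [factorizationTrunc, factorization_prod fun p hp =>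
    pow_ne_zero _ (prime_of_mem_primeFactors hp).ne_zero, Finset.sum_apply']
  rw [Finset.sum_congr rfl fun p hp => show _ = if q = p then min j (n.factorization q) else 0 by
    rw [(prime_of_mem_primeFactors hp).factorization_pow, Finsupp.single_apply]
    by_cases hpq : p = q
    · rw [if_pos hpq, if_pos hpq.symm, hpq]
    · rw [if_neg hpq, if_neg (Ne.symm hpq)]]
  rw [Finset.sum_ite_eq]
  split_ifs with hq
  · rfl
  · rw [← support_factorization, Finsupp.notMem_support_iff] at hq
    simp [hq]

theorem factorizationTrunc_dvd_iff {n j m : ℕ} (hm : m ≠ 0) :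
    n.factorizationTrunc j ∣ m ↔ ∀ q, min j (n.factorization q) ≤ m.factorization q := by
  rw [← factorization_le_iff_dvd (factorizationTrunc_ne_zero n j) hm, Finsupp.le_def]
  simp only [factorization_factorizationTrunc]

theorem factorizationTrunc_dvd (n j : ℕ) (hn : n ≠ 0) : n.factorizationTrunc j ∣ n :=
  (factorizationTrunc_dvd_iff hn).mpr fun _ => min_le_right _ _

theorem factorization_prime_mul_factorizationTrunc {p : ℕ} (hp : p.Prime) (n j q : ℕ) :
    (p * n.factorizationTrunc j).factorization q =
      (if p = q then 1 else 0) + min j (n.factorization q) := by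
  rw [factorization_mul hp.ne_zero (factorizationTrunc_ne_zero n j), Finsupp.add_apply,
    hp.factorization, Finsupp.single_apply, factorization_factorizationTrunc]

theorem prime_mul_factorizationTrunc_dvd_iff {p n j : ℕ} (hp : p.Prime) (hn : n ≠ 0) :
    p * n.factorizationTrunc j ∣ n ↔ j < n.factorization p := by
  rw [← factorization_le_iff_dvd (mul_ne_zero hp.ne_zero (factorizationTrunc_ne_zero n j)) hn,
    Finsupp.le_def]
  simp only [factorization_prime_mul_factorizationTrunc hp]
  refine ⟨fun h => ?_, fun h q => ?_⟩
  · have := h p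
    rw [if_pos rfl] at this
    omega
  · split_ifs with hpq
    · subst hpq
      omega
    · omega

theorem prime_mul_factorizationTrunc_dvd_succ {p n j : ℕ} (hp : p.Prime)
    (h : j < n.factorization p) :
    p * n.factorizationTrunc j ∣ n.factorizationTrunc (j + 1) := by
  rw [← factorization_le_iff_dvd (mul_ne_zero hp.ne_zero (factorizationTrunc_ne_zero n j))
    (factorizationTrunc_ne_zero n _), Finsupp.le_def]
  intro q
  rw [factorization_prime_mul_factorizationTrunc hp, factorization_factorizationTrunc]
  split_ifs with hpq
  · subst hpq
    omega
  · omega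

theorem factorizationTrunc_eq_self_iff {n j : ℕ} (hn : n ≠ 0) :
    n.factorizationTrunc j = n ↔ n.primeFactors.sup n.factorization ≤ j := by
  rw [Finset.sup_le_iff]
  refine ⟨fun h p _ => ?_, fun h => ?_⟩
  · have hp := factorization_factorizationTrunc n j p
    rw [h] at hp
    omega
  · refine eq_of_factorization_eq (factorizationTrunc_ne_zero n j) hn fun q => ?_
    rw [factorization_factorizationTrunc, min_eq_right_iff]
    by_cases hq : q ∈ n.primeFactors
    · exact h q hq
    · rw [← support_factorization, Finsupp.notMem_support_iff] at hq
      simp [hq]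

end Nat

open IntermediateField in
theorem finrank_loewySeriesField_of_isCyclic {k L : Type*} [Field k] [Field L] [Algebra k L]
    [FiniteDimensional k L] [IsGalois k L] [IsCyclic (L ≃ₐ[k] L)] (j : ℕ) :
    Module.finrank k (loewySeriesField k L j) = (Module.finrank k L).factorizationTrunc j := by
  have hn : Module.finrank k L ≠ 0 := Module.finrank_pos.ne'
  induction j with
  | zero =>
    rw [loewySeriesField, IntermediateField.finrank_bot]
    simp [Nat.factorizationTrunc]
  | succ j ih =>
    obtain ⟨T, hT⟩ := exists_finrank_eq_of_isCyclic (k := k) (L := L)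
      (Nat.factorizationTrunc_dvd (Module.finrank k L) (j + 1) hn)
    suffices loewySeriesField k L (j + 1) = T by rw [this, hT]
    apply le_antisymm
    · refine sup_le ?_ (sSup_le fun A hA => ?_)
      · rw [le_iff_finrank_dvd_of_isCyclic, ih, hT,
          Nat.factorizationTrunc_dvd_iff (Nat.factorizationTrunc_ne_zero _ _)]
        intro q
        rw [Nat.factorization_factorizationTrunc]
        omega
      · obtain ⟨p, hp, hpA⟩ := exists_prime_finrank_eq_mul_of_covBy hA
        rw [ih] at hpA
        rw [le_iff_finrank_dvd_of_isCyclic, hpA, hT]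
        exact Nat.prime_mul_factorizationTrunc_dvd_succ hp
          ((Nat.prime_mul_factorizationTrunc_dvd_iff hp hn).mp (hpA ▸ finrank_dvd_finrank A))
    · have hm : Module.finrank k (loewySeriesField k L (j + 1)) ≠ 0 := Module.finrank_pos.ne'
      rw [le_iff_finrank_dvd_of_isCyclic, hT, Nat.factorizationTrunc_dvd_iff hm]
      intro q
      rcases Nat.lt_or_ge j ((Module.finrank k L).factorization q) with hq | hq
      · have hqp : q.Prime := by
          by_contra hnp
          simp [Nat.factorization_eq_zero_of_not_prime _ hnp] at hq
        obtain ⟨B, hB⟩ := exists_finrank_eq_of_isCyclic (k := k) (L := L)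
          ((Nat.prime_mul_factorizationTrunc_dvd_iff hqp hn).mpr hq)
        have hcov : loewySeriesField k L j ⋖ B := covBy_of_finrank_eq_prime_mul hqp
          (le_iff_finrank_dvd_of_isCyclic.mpr (by rw [hB, ih]; exact dvd_mul_left _ _))
          (by rw [hB, ih])
        have hle : B ≤ loewySeriesField k L (j + 1) := le_sup_of_le_right (le_sSup hcov)
        have hfac := factorization_finrank_le_of_le hle q
        rw [hB, Nat.factorization_prime_mul_factorizationTrunc hqp, if_pos rfl] at hfac
        omega
      · have hle : loewySeriesField k L j ≤ loewySeriesField k L (j + 1) := le_sup_left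
        have hfac := factorization_finrank_le_of_le hle q
        rw [ih, Nat.factorization_factorizationTrunc] at hfac
        omega

theorem cyclic_galois_loewySeries_finrank
    {k L : Type*} [Field k] [Field L] [Algebra k L]
    [FiniteDimensional k L] [IsGalois k L] [IsCyclic (L ≃ₐ[k] L)]
    (hkL : (⊥ : IntermediateField k L) ≠ ⊤) :
    (∀ j : ℕ, Module.finrank k ↥(loewySeriesField k L j) =
      ∏ p ∈ (Module.finrank k L).primeFactors,
        p ^ min j ((Module.finrank k L).factorization p)) ∧
    IsLeast {m : ℕ | loewySeriesField k L m = ⊤}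
      ((Module.finrank k L).primeFactors.sup
        fun p => (Module.finrank k L).factorization p) := by
  refine ⟨finrank_loewySeriesField_of_isCyclic, ?_⟩
  have key (m : ℕ) : loewySeriesField k L m = ⊤ ↔
      (Module.finrank k L).primeFactors.sup (Module.finrank k L).factorization ≤ m := by
    rw [← Nat.factorizationTrunc_eq_self_iff Module.finrank_pos.ne',
      ← finrank_loewySeriesField_of_isCyclic]
    refine ⟨fun h => by rw [h, IntermediateField.finrank_top'], fun h => ?_⟩
    exact IntermediateField.eq_of_le_of_finrank_eq le_top
      (by rw [h, IntermediateField.finrank_top'])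
  exact ⟨(key _).mpr le_rfl, fun m hm => (key m).mp hm⟩
end

section
/- Let k ⊆ L be a finite Galois field extension and let Σ := sSup {A ∈ [k,L] | A is an atom} be the socle of [k,L]. Then Σ is globally invariant under the Galois group, i.e. Σ.map σ = Σ for every σ : L ≃ₐ[k] L, and the extension k ⊆ Σ is Galois (IsGalois k Σ). -/
/-- The automorphism of the lattice of intermediate fields induced by an automorphism of the
top field. -/
def IntermediateField.mapOrderIso {k L : Type*} [Field k] [Field L] [Algebra k L]
    (σ : L ≃ₐ[k] L) : IntermediateField k L ≃o IntermediateField k L where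
  toFun A := A.map (σ : L →ₐ[k] L)
  invFun A := A.map (σ.symm : L →ₐ[k] L)
  left_inv A := by simp [IntermediateField.map_map, IntermediateField.map_id]
  right_inv A := by simp [IntermediateField.map_map, IntermediateField.map_id]
  map_rel_iff' := Set.image_subset_image_iff σ.injective

/-- An order isomorphism maps the supremum of the atoms to the supremum of the atoms. -/
theorem OrderIso.map_sSup_isAtom {α β : Type*} [CompleteLattice α] [CompleteLattice β]
    (e : α ≃o β) : e (sSup {a | IsAtom a}) = sSup {b | IsAtom b} := by
  rw [e.map_sSup_eq_sSup_symm_preimage]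
  congr 1
  ext b
  exact e.symm.isAtom_iff b

theorem socle_galois_invariant_and_galois
    {k L : Type*} [Field k] [Field L] [Algebra k L]
    [FiniteDimensional k L] [IsGalois k L] :
    (∀ σ : L ≃ₐ[k] L,
      (sSup {A : IntermediateField k L | IsAtom A}).map (σ : L →ₐ[k] L) =
        sSup {A : IntermediateField k L | IsAtom A}) ∧
    IsGalois k ↥(sSup {A : IntermediateField k L | IsAtom A}) := by
  have map_eq (σ : L ≃ₐ[k] L) :
      (sSup {A : IntermediateField k L | IsAtom A}).map (σ : L →ₐ[k] L) =
        sSup {A : IntermediateField k L | IsAtom A} :=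
    (IntermediateField.mapOrderIso σ).map_sSup_isAtom
  have := IntermediateField.normal_iff_forall_map_eq'.2 map_eq
  exact ⟨map_eq, ⟨⟩⟩
end
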